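/- Let H ∈ (0, 1). The fractional Brownian motion covariance kernel K_H(s, t) := ½(s^{2H} + t^{2H} - |t - s|^{2H}) is positive semidefinite on [0, ∞): for every n ∈ ℕ, every t_1, …, t_n ∈ [0, ∞) and every a_1, …, a_n ∈ ℝ, ∑_{i=1}^{n} ∑_{j=1}^{n} a_i a_j K_H(t_i, t_j) ≥ 0. -/

import Mathlib

open Real Finset

open MeasureTheory in
theorem integrableOn_rpow_mul_one_sub_cos {p : ℝ} (hp : p ∈ Set.Ioo (0 : ℝ) 2) (x : ℝ) :
    IntegrableOn (fun u : ℝ => u ^ (-1 - p) * (1 - cos (u * x))) (Set.Ioi 0) := by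
  obtain ⟨hp0, hp2⟩ := hp
  have hmeas : Measurable (fun u : ℝ => u ^ (-1 - p) * (1 - cos (u * x))) := by fun_prop
  rw [← Set.Ioc_union_Ioi_eq_Ioi zero_le_one]
  refine IntegrableOn.union ?_ ?_
  · have h : IntegrableOn (fun u : ℝ => u ^ (1 - p) * (x ^ 2 / 2)) (Set.Ioc 0 1) :=
      (((intervalIntegrable_iff_integrableOn_Ioc_of_le zero_le_one).mp
        (intervalIntegral.intervalIntegrable_rpow' (by linarith)))).mul_const _
    refine h.mono' hmeas.aestronglyMeasurable ?_
    filter_upwards [ae_restrict_mem measurableSet_Ioc] with u hu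
    have hu0 : 0 < u := hu.1
    have hcos := cos_le_one (u * x)
    have hquad := one_sub_sq_div_two_le_cos (x := u * x)
    have hpow : u ^ (1 - p) = u ^ (-1 - p) * u ^ 2 := by
      rw [← rpow_natCast u 2, ← rpow_add hu0]; congr 1; push_cast; ring
    rw [norm_of_nonneg (mul_nonneg (rpow_nonneg hu0.le _) (by linarith)), hpow, mul_assoc]
    gcongr
    linarith
  · have h : IntegrableOn (fun u : ℝ => u ^ (-1 - p) * 2) (Set.Ioi 1) :=
      (integrableOn_Ioi_rpow_of_lt (by linarith) one_pos).mul_const _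
    refine h.mono' hmeas.aestronglyMeasurable ?_
    filter_upwards [ae_restrict_mem measurableSet_Ioi] with u hu
    have hu0 : 0 < u := one_pos.trans hu
    have hcos := cos_le_one (u * x)
    have hcos' := neg_one_le_cos (u * x)
    rw [norm_of_nonneg (mul_nonneg (rpow_nonneg hu0.le _) (by linarith))]
    gcongr
    linarith

open MeasureTheory in
theorem integral_rpow_mul_one_sub_cos_pos {p : ℝ} (hp : p ∈ Set.Ioo (0 : ℝ) 2) :
    0 < ∫ u in Set.Ioi (0 : ℝ), u ^ (-1 - p) * (1 - cos u) := by
  have hint := integrableOn_rpow_mul_one_sub_cos hp 1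
  simp only [mul_one] at hint
  rw [setIntegral_pos_iff_support_of_nonneg_ae _ hint]
  · refine lt_of_lt_of_le ?_ (measure_mono (s := Set.Ioo (0 : ℝ) 1) ?_)
    · simp
    · intro u hu
      refine ⟨?_, hu.1⟩
      have hcos : cos u < 1 := by
        simpa using cos_lt_cos_of_nonneg_of_le_pi le_rfl
          (by linarith [hu.2, pi_gt_three]) hu.1
      exact (mul_pos (rpow_pos_of_pos hu.1 _) (by linarith)).ne'
  · filter_upwards [ae_restrict_mem measurableSet_Ioi] with u hu
    exact mul_nonneg (rpow_nonneg (le_of_lt hu) _) (by linarith [cos_le_one u])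

theorem integral_rpow_mul_one_sub_cos_mul {p : ℝ} (hp : p ≠ 0) (x : ℝ) :
    ∫ u in Set.Ioi (0 : ℝ), u ^ (-1 - p) * (1 - cos (u * x)) =
      |x| ^ p * ∫ u in Set.Ioi (0 : ℝ), u ^ (-1 - p) * (1 - cos u) := by
  rcases eq_or_ne x 0 with rfl | hx
  · simp [zero_rpow hp]
  have hx' : 0 < |x| := abs_pos.mpr hx
  have hscale := MeasureTheory.integral_comp_mul_left_Ioi
    (fun u : ℝ => u ^ (-1 - p) * (1 - cos u)) 0 hx'
  rw [mul_zero, smul_eq_mul] at hscale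
  have hpow : |x| ^ p = |x| ^ (1 + p) * |x|⁻¹ := by
    rw [← rpow_neg_one, ← rpow_add hx']; congr 1; ring
  rw [hpow, mul_assoc, ← hscale, ← MeasureTheory.integral_const_mul]
  refine MeasureTheory.setIntegral_congr_fun measurableSet_Ioi fun u hu => ?_
  have hu0 : 0 < u := hu
  have hcancel : |x| ^ (1 + p) * |x| ^ (-1 - p) = 1 := by
    rw [← rpow_add hx']; ring_nf; exact rpow_zero _
  have hcos : cos (|x| * u) = cos (u * x) := by
    rw [← cos_abs (u * x), abs_mul, abs_of_pos hu0, mul_comm]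
  simp only [hcos]
  rw [mul_rpow hx'.le hu0.le, ← mul_assoc, ← mul_assoc, hcancel, one_mul]

theorem sum_sum_mul_one_sub_cos_nonneg {ι : Type*} [Fintype ι] (a θ : ι → ℝ) :
    0 ≤ ∑ i, ∑ j, a i * a j *
      ((1 - cos (θ i)) + (1 - cos (θ j)) - (1 - cos (θ i - θ j))) := by
  have h : ∑ i, ∑ j, a i * a j *
      ((1 - cos (θ i)) + (1 - cos (θ j)) - (1 - cos (θ i - θ j))) =
      (∑ i, a i * (1 - cos (θ i))) ^ 2 + (∑ i, a i * sin (θ i)) ^ 2 := by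
    simp only [sq, Finset.sum_mul_sum, ← Finset.sum_add_distrib]
    refine Finset.sum_congr rfl fun i _ => Finset.sum_congr rfl fun j _ => ?_
    rw [cos_sub]
    ring
  rw [h]
  positivity

/-- Positive semidefiniteness of the fractional Brownian motion covariance kernel
`K_H(s,t) = ½(s^{2H} + t^{2H} - |t-s|^{2H})` on `[0, ∞)`, for any Hurst index
`H ∈ (0,1)`. -/
theorem fbm_kernel_posSemidef
    (H : ℝ) (hH : H ∈ Set.Ioo (0 : ℝ) 1) :
    ∀ (n : ℕ) (t : Fin n → ℝ) (a : Fin n → ℝ), (∀ i, 0 ≤ t i) →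
      0 ≤ ∑ i, ∑ j, a i * a j *
        ((1 : ℝ)/2 * ((t i) ^ (2*H) + (t j) ^ (2*H) - |t i - t j| ^ (2*H))) := by
  intro n t a ht
  have hp : 2 * H ∈ Set.Ioo (0 : ℝ) 2 := ⟨by linarith [hH.1], by linarith [hH.2]⟩
  have hC := integral_rpow_mul_one_sub_cos_pos hp
  set C := ∫ u in Set.Ioi (0 : ℝ), u ^ (-1 - 2 * H) * (1 - cos u)
  let F : ℝ → ℝ → ℝ := fun x u => u ^ (-1 - 2 * H) * (1 - cos (u * x))
  have hrep (x : ℝ) : ∫ u in Set.Ioi (0 : ℝ), F x u = |x| ^ (2 * H) * C :=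
    integral_rpow_mul_one_sub_cos_mul hp.1.ne' x
  have hint (x : ℝ) : MeasureTheory.Integrable (F x)
      (MeasureTheory.volume.restrict (Set.Ioi 0)) :=
    integrableOn_rpow_mul_one_sub_cos hp x
  have hterm (i j : Fin n) : MeasureTheory.IntegrableOn
      (fun u => a i * a j * (F (t i) u + F (t j) u - F (t i - t j) u)) (Set.Ioi 0) :=
    (((hint (t i)).add (hint (t j))).sub (hint (t i - t j))).const_mul _
  have hsum : ∫ u in Set.Ioi (0 : ℝ),
      ∑ i, ∑ j, a i * a j * (F (t i) u + F (t j) u - F (t i - t j) u) =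
      2 * C * ∑ i, ∑ j, a i * a j *
        ((1 : ℝ)/2 * ((t i) ^ (2*H) + (t j) ^ (2*H) - |t i - t j| ^ (2*H))) := by
    rw [MeasureTheory.integral_finsetSum _
      fun i _ => MeasureTheory.integrable_finsetSum _ fun j _ => hterm i j, Finset.mul_sum]
    refine Finset.sum_congr rfl fun i _ => ?_
    rw [MeasureTheory.integral_finsetSum _ fun j _ => hterm i j, Finset.mul_sum]
    refine Finset.sum_congr rfl fun j _ => ?_
    rw [MeasureTheory.integral_const_mul,
      MeasureTheory.integral_sub (f := fun u => F (t i) u + F (t j) u)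
        ((hint (t i)).add (hint (t j))) (hint (t i - t j)),
      MeasureTheory.integral_add (hint (t i)) (hint (t j)), hrep, hrep, hrep,
      abs_of_nonneg (ht i), abs_of_nonneg (ht j)]
    ring
  rw [← mul_nonneg_iff_of_pos_left (mul_pos two_pos hC), ← hsum]
  refine MeasureTheory.setIntegral_nonneg measurableSet_Ioi fun u hu => ?_
  have hu0 : 0 < u := hu
  have hpoint := mul_nonneg (rpow_nonneg hu0.le (-1 - 2 * H))
    (sum_sum_mul_one_sub_cos_nonneg a fun i => u * t i)
  refine hpoint.trans_eq ?_
  simp only [Finset.mul_sum, F]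
  refine Finset.sum_congr rfl fun i _ => Finset.sum_congr rfl fun j _ => ?_
  rw [mul_sub u]
  ring
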